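/- Let e≥2, s∈𝒜^l_e, and let 𝛌 and 𝛍 be two l-partitions of the same rank n. Then the core of (𝛌,s) equals the core of (𝛍,s) if and only if C_{e,s}(𝛌)=C_{e,s}(𝛍). -/

import Mathlib

noncomputable section

/-- A partition: a nonincreasing sequence of nonnegative integers with finitely many
nonzero terms. `parts j` is the `(j+1)`-st part `λ_{j+1}` (0-indexed). -/
structure Ptn where
  parts : ℕ → ℕ
  antitone' : ∀ ⦃i j : ℕ⦄, i ≤ j → parts j ≤ parts i
  eventually_zero : ∃ N, ∀ n, N ≤ n → parts n = 0

/-- The empty partition. -/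
def Ptn.empty : Ptn := ⟨fun _ => 0, fun _ _ _ => le_rfl, ⟨0, fun _ _ => rfl⟩⟩

/-- The abacus `L_s(λ) = {λ_j − j + s : j ∈ ℤ_{>0}}` of a partition with charge `s`. -/
def abacus (s : ℤ) (lam : Ptn) : Set ℤ :=
  {x | ∃ j : ℕ, x = (lam.parts j : ℤ) - ((j : ℤ) + 1) + s}

/-- The Young diagram of an `l`-partition, with 0-indexed rows and columns:
`(a, b, c) ∈ diag 𝛌` represents the node in row `a+1`, column `b+1` of component `c`. -/
def diag {l : ℕ} (lam : Fin l → Ptn) : Set (ℕ × ℕ × Fin l) :=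
  {x | x.2.1 < (lam x.2.2).parts x.1}

/-- The rank of an `l`-partition: the number of nodes of its Young diagram. -/
def rank {l : ℕ} (lam : Fin l → Ptn) : ℕ := (diag lam).ncard

/-- The rank of a partition. -/
def rank₁ (lam : Ptn) : ℕ := rank (fun _ : Fin 1 => lam)

/-- The residue of the node `(a,b,c)` (0-indexed), i.e. `(b+1) − (a+1) + s_c mod e`. -/
def res (e : ℕ) {l : ℕ} (s : Fin l → ℤ) (x : ℕ × ℕ × Fin l) : ZMod e :=
  (((x.2.1 : ℤ) - (x.1 : ℤ) + s x.2.2 : ℤ) : ZMod e)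

/-- `c^{e,s}_i(𝛌)`: the number of nodes of `𝛌` of residue `i`. -/
def resCount (e : ℕ) {l : ℕ} (s : Fin l → ℤ) (lam : Fin l → Ptn) (i : ZMod e) : ℕ :=
  {x ∈ diag lam | res e s x = i}.ncard

/-- `c^{e,(t)}_i(λ)` for a single partition with charge `t`. -/
def resCount₁ (e : ℕ) (t : ℤ) (lam : Ptn) (i : ZMod e) : ℕ :=
  resCount e (fun _ : Fin 1 => t) (fun _ => lam) i

/-- A node `γ` of `𝛌` is removable if deleting it yields the Young diagram
of an `l`-partition. -/
def Removable {l : ℕ} (lam : Fin l → Ptn) (γ : ℕ × ℕ × Fin l) : Prop :=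
  γ ∈ diag lam ∧ ∃ mu : Fin l → Ptn, diag mu = diag lam \ {γ}

/-- A node `γ ∉ [𝛌]` is addable for `𝛌` if adding it yields the Young diagram
of an `l`-partition. -/
def Addable {l : ℕ} (lam : Fin l → Ptn) (γ : ℕ × ℕ × Fin l) : Prop :=
  γ ∉ diag lam ∧ ∃ mu : Fin l → Ptn, diag mu = diag lam ∪ {γ}

/-- `M^s_i(𝛌)`: the number of addable nodes of residue `i` minus the number of
removable nodes of residue `i`. -/
def Mnum (e : ℕ) {l : ℕ} (s : Fin l → ℤ) (lam : Fin l → Ptn) (i : ZMod e) : ℤ :=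
  ({γ | Addable lam γ ∧ res e s γ = i}.ncard : ℤ) -
    ({γ | Removable lam γ ∧ res e s γ = i}.ncard : ℤ)

/-- `M^{(t)}_i(λ)` for a single partition with charge `t`. -/
def Mnum₁ (e : ℕ) (t : ℤ) (lam : Ptn) (i : ZMod e) : ℤ :=
  Mnum e (fun _ : Fin 1 => t) (fun _ => lam) i

/-- The block `(e,s)`-weight of Fayers:
`p_{(e,s)}(𝛌) = Σ_{i=1}^{l} c_{s_i}(𝛌) − (1/2) Σ_{i ∈ ℤ/eℤ} (c_i(𝛌) − c_{i−1}(𝛌))²`. -/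
def blockWeight (e : ℕ) {l : ℕ} (s : Fin l → ℤ) (lam : Fin l → Ptn) : ℚ :=
  (∑ i : Fin l, (resCount e s lam ((s i : ZMod e)) : ℚ)) -
    (1 / 2) * ∑ i ∈ Finset.range e,
      ((resCount e s lam ((i : ZMod e)) : ℚ) - (resCount e s lam ((i : ZMod e) - 1) : ℚ)) ^ 2

/-- Block weight of a single partition with charge `t`. -/
def blockWeight₁ (e : ℕ) (t : ℤ) (lam : Ptn) : ℚ :=
  blockWeight e (fun _ : Fin 1 => t) (fun _ => lam)

/-- The `l`-abacus `(L_{s_1}(λ^1),…,L_{s_l}(λ^l))` is `(e,s)`-complete: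
`L_{s_1}(λ^1) ⊆ … ⊆ L_{s_l}(λ^l) ⊆ {x+e : x ∈ L_{s_1}(λ^1)}`. -/
def Complete (e : ℕ) {l : ℕ} (s : Fin l → ℤ) (lam : Fin l → Ptn) : Prop :=
  (∀ i j : Fin l, (j : ℕ) = (i : ℕ) + 1 →
      abacus (s i) (lam i) ⊆ abacus (s j) (lam j)) ∧
  (∀ i j : Fin l, (i : ℕ) = l - 1 → (j : ℕ) = 0 →
      abacus (s i) (lam i) ⊆ {x | x - (e : ℤ) ∈ abacus (s j) (lam j)})

/-- `𝒜̄^l_e = {s ∈ ℤ^l : 0 ≤ s_j − s_i ≤ e for all i < j}`. -/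
def Abar (e : ℕ) {l : ℕ} (s : Fin l → ℤ) : Prop :=
  ∀ i j : Fin l, i < j → 0 ≤ s j - s i ∧ s j - s i ≤ (e : ℤ)

/-- `𝒜^l_e = {s ∈ ℤ^l : 0 ≤ s_j − s_i < e for all i < j}`. -/
def Aset (e : ℕ) {l : ℕ} (s : Fin l → ℤ) : Prop :=
  ∀ i j : Fin l, i < j → 0 ≤ s j - s i ∧ s j - s i < (e : ℤ)

/-- A partition is an `e`-core if its abacus is stable under subtracting `e`
(a condition independent of the charge). -/
def IsECore (e : ℕ) (lam : Ptn) : Prop :=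
  ∀ x ∈ abacus 0 lam, x - (e : ℤ) ∈ abacus 0 lam

/-- The permutation `σ_s`: the unique permutation sorting the residues
`s'_i = s_i mod e ∈ {0,…,e−1}` increasingly and stably. -/
def sigmaPerm (e : ℕ) {l : ℕ} (s : Fin l → ℤ) : Equiv.Perm (Fin l) :=
  Tuple.sort (fun i => s i % (e : ℤ))

/-- `𝛌` is an `(e,s)`-core if `𝛌^{σ_s}` is a reduced `(e, s̃^{σ_s})`-core. -/
def IsCore (e : ℕ) {l : ℕ} (s : Fin l → ℤ) (lam : Fin l → Ptn) : Prop :=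
  Complete e (fun i => s (sigmaPerm e s i) % (e : ℤ)) (fun i => lam (sigmaPerm e s i))

/-- The set `{(l−c)e + q·e·l + r : 1 ≤ c ≤ l, q ∈ ℤ, 0 ≤ r ≤ e−1, qe+r ∈ L_{s_c}(λ^c)}`
(with `c = (c' : Fin l) + 1`). -/
def uglovSet (e : ℕ) {l : ℕ} (s : Fin l → ℤ) (lam : Fin l → Ptn) : Set ℤ :=
  {y | ∃ (c : Fin l) (q : ℤ) (r : ℕ), r < e ∧
      (q * (e : ℤ) + (r : ℤ)) ∈ abacus (s c) (lam c) ∧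
      y = ((l : ℤ) - 1 - ((c : ℕ) : ℤ)) * (e : ℤ) + q * (e : ℤ) * (l : ℤ) + (r : ℤ)}

/-- `μ = τ_{e,s}(𝛌)`: the Uglov map sends `𝛌` to the unique partition `μ` whose abacus
with charge `t = s_1 + … + s_l` is the Uglov set of `(𝛌,s)`. -/
def IsUglov (e : ℕ) {l : ℕ} (s : Fin l → ℤ) (lam : Fin l → Ptn) (mu : Ptn) : Prop :=
  abacus (∑ i, s i) mu = uglovSet e s lam

/-- An elementary operation on a pair (`l`-partition, multicharge), performed on the
associated `l`-abacus. -/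
def ElemOp (e : ℕ) {l : ℕ} (p q : (Fin l → Ptn) × (Fin l → ℤ)) : Prop :=
  (∃ (i j : Fin l) (x : ℤ), (j : ℕ) = (i : ℕ) + 1 ∧
      x ∈ abacus (p.2 i) (p.1 i) ∧ x ∉ abacus (p.2 j) (p.1 j) ∧
      abacus (q.2 i) (q.1 i) = abacus (p.2 i) (p.1 i) \ {x} ∧
      abacus (q.2 j) (q.1 j) = abacus (p.2 j) (p.1 j) ∪ {x} ∧
      q.2 i = p.2 i - 1 ∧ q.2 j = p.2 j + 1 ∧
      (∀ k, k ≠ i → k ≠ j → q.1 k = p.1 k ∧ q.2 k = p.2 k)) ∨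
  (∃ (i j : Fin l) (x : ℤ), (i : ℕ) = l - 1 ∧ (j : ℕ) = 0 ∧
      x ∈ abacus (p.2 i) (p.1 i) ∧ x - (e : ℤ) ∉ abacus (p.2 j) (p.1 j) ∧
      (i = j → abacus (q.2 i) (q.1 i) = (abacus (p.2 i) (p.1 i) \ {x}) ∪ {x - (e : ℤ)} ∧
        q.2 i = p.2 i) ∧
      (i ≠ j → abacus (q.2 i) (q.1 i) = abacus (p.2 i) (p.1 i) \ {x} ∧
        abacus (q.2 j) (q.1 j) = abacus (p.2 j) (p.1 j) ∪ {x - (e : ℤ)} ∧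
        q.2 i = p.2 i - 1 ∧ q.2 j = p.2 j + 1) ∧
      (∀ k, k ≠ i → k ≠ j → q.1 k = p.1 k ∧ q.2 k = p.2 k))

/-- A sequence of `n` elementary operations starting from `p`. -/
def OpSeq (e : ℕ) {l : ℕ} (p : (Fin l → Ptn) × (Fin l → ℤ))
    (f : ℕ → (Fin l → Ptn) × (Fin l → ℤ)) (n : ℕ) : Prop :=
  f 0 = p ∧ ∀ k < n, ElemOp e (f k) (f (k + 1))

/-- A maximal sequence of elementary operations: performed until the resulting
`l`-abacus is complete for the current multicharge. -/
def MaxOpSeq (e : ℕ) {l : ℕ} (p : (Fin l → Ptn) × (Fin l → ℤ))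
    (f : ℕ → (Fin l → Ptn) × (Fin l → ℤ)) (n : ℕ) : Prop :=
  OpSeq e p f n ∧ Complete e (f n).2 (f n).1

/-- `q` is the core of the pair `p`: it is reached from `p` by a maximal sequence
of elementary operations. -/
def IsCorePairOf (e : ℕ) {l : ℕ} (p q : (Fin l → Ptn) × (Fin l → ℤ)) : Prop :=
  ∃ f n, MaxOpSeq e p f n ∧ f n = q

/-- `κ = Core_e(λ)`: on abaci, the abacus of `κ` is obtained from that of `λ` by
repeatedly replacing an element `y` with `y − e ∉ L` by `y − e`, until no such
replacement is possible. -/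
def IsECoreOf (e : ℕ) (kappa lam : Ptn) : Prop :=
  IsECore e kappa ∧ ∃ (f : ℕ → Ptn) (m : ℕ), f 0 = lam ∧ f m = kappa ∧
    ∀ k < m, ∃ y ∈ abacus 0 (f k), y - (e : ℤ) ∉ abacus 0 (f k) ∧
      abacus 0 (f (k + 1)) = (abacus 0 (f k) \ {y}) ∪ {y - (e : ℤ)}

end


open Classical in
/-- Integer-valued indicator of a set. -/
noncomputable def ind (A : Set ℤ) (x : ℤ) : ℤ := if x ∈ A then 1 else 0

/-- Sets containing all very negative and no very positive integers. -/
def Maya (A : Set ℤ) : Prop := ∃ a b : ℤ, (∀ x, x < a → x ∈ A) ∧ (∀ x, b ≤ x → x ∉ A)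

/-- Weight of `A` relative to the vacuum `V`. -/
noncomputable def W (V : Set ℤ) (f : ℤ → ℤ) (A : Set ℤ) : ℤ := ∑ᶠ x, f x * (ind A x - ind V x)

theorem supp_fin {A V : Set ℤ} (hA : Maya A) (hV : Maya V) (f : ℤ → ℤ) :
    (Function.support fun x => f x * (ind A x - ind V x)).Finite := by
  obtain ⟨a, b, h1, h2⟩ := hA
  obtain ⟨c, d, h3, h4⟩ := hV
  apply (Set.finite_Ico (min a c) (max b d)).subset
  intro x hx
  by_contra hn
  apply hx
  simp only [Set.mem_Ico, not_and_or, not_le, not_lt, lt_min_iff, max_le_iff] at hn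
  rcases hn with hn | hn
  · simp [ind, h1 x hn.1, h3 x hn.2]
  · simp [ind, h2 x hn.1, h4 x hn.2]

theorem maya_union {A : Set ℤ} (hA : Maya A) (x : ℤ) : Maya (A ∪ {x}) := by
  obtain ⟨a, b, h1, h2⟩ := hA
  refine ⟨a, max b (x + 1), fun y hy => Or.inl (h1 y hy), fun y hy => ?_⟩
  rintro (h | h)
  · exact h2 y (le_trans (le_max_left _ _) hy) h
  · have := le_trans (le_max_right b (x + 1)) hy
    simp at h
    omega

theorem maya_diff {A : Set ℤ} (hA : Maya A) (x : ℤ) : Maya (A \ {x}) := by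
  obtain ⟨a, b, h1, h2⟩ := hA
  refine ⟨min a x, b, fun y hy => ⟨h1 y (lt_of_lt_of_le hy (min_le_left _ _)), ?_⟩,
    fun y hy h => h2 y hy h.1⟩
  have := lt_of_lt_of_le hy (min_le_right a x)
  simp
  omega

theorem maya_Iio (s : ℤ) : Maya {x | x < s} :=
  ⟨s, s, fun _ h => h, fun x h h' => by simp at h'; omega⟩

theorem W_insert {A V : Set ℤ} (hA : Maya A) (hV : Maya V) (f : ℤ → ℤ) {x : ℤ} (hx : x ∉ A) :
    W V f (A ∪ {x}) = W V f A + f x := by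
  have h : W V f (A ∪ {x}) - W V f A = f x := by
    unfold W
    rw [← finsum_sub_distrib (supp_fin (maya_union hA x) hV f) (supp_fin hA hV f)]
    rw [finsum_eq_single _ x]
    · have h1 : ind (A ∪ {x}) x = 1 := by simp [ind]
      have h2 : ind A x = 0 := by simp [ind, hx]
      rw [h1, h2]; ring
    · intro y hy
      have h1 : ind (A ∪ {x}) y = ind A y := by
        have : y ∈ A ∪ {x} ↔ y ∈ A := by simp [hy]
        unfold ind
        split_ifs with h3 h4 h4 <;> first | rfl | (exfalso; tauto)
      rw [h1]; ring
  linarith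

theorem W_diff {A V : Set ℤ} (hA : Maya A) (hV : Maya V) (f : ℤ → ℤ) {x : ℤ} (hx : x ∈ A) :
    W V f (A \ {x}) = W V f A - f x := by
  have h := W_insert (maya_diff hA x) hV f (x := x) (by simp)
  have : A \ {x} ∪ {x} = A := by
    ext y; by_cases hy : y = x <;> simp [hy, hx]
  rw [this] at h
  linarith

theorem maya_union_finset {A : Set ℤ} (hA : Maya A) (T : Finset ℤ) : Maya (A ∪ (T : Set ℤ)) := by
  classical
  induction T using Finset.induction_on with
  | empty => simpa using hA
  | insert a T ha ih =>
    have := maya_union ih a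
    rw [Set.union_assoc] at this
    convert this using 2
    ext y; simp

theorem W_finset {A V : Set ℤ} (hA : Maya A) (hV : Maya V) (f : ℤ → ℤ) (T : Finset ℤ)
    (hT : ∀ x ∈ T, x ∉ A) : W V f (A ∪ (T : Set ℤ)) = W V f A + ∑ x ∈ T, f x := by
  classical
  induction T using Finset.induction_on with
  | empty => simp
  | insert a T ha ih =>
    have h1 := W_insert (maya_union_finset hA T) hV f (x := a)
      (by simp [ha, hT a (by simp)])
    rw [ih (fun x hx => hT x (by simp [hx]))] at h1
    rw [Finset.sum_insert ha]
    have : A ∪ ((insert a T : Finset ℤ) : Set ℤ) = A ∪ (T : Set ℤ) ∪ {a} := by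
      ext y; simp
    rw [this, h1]; ring

theorem W_mono {A B V : Set ℤ} (hA : Maya A) (hB : Maya B) (hV : Maya V) (f : ℤ → ℤ)
    (h : ∀ x, f x * ind A x ≤ f x * ind B x) : W V f A ≤ W V f B := by
  apply finsum_le_finsum' (supp_fin hA hV f) (supp_fin hB hV f)
  intro x
  have := h x
  simp only [mul_sub]
  linarith

theorem W_mono_eq {A B V : Set ℤ} (hA : Maya A) (hB : Maya B) (hV : Maya V) (f : ℤ → ℤ)
    (h : ∀ x, f x * ind A x ≤ f x * ind B x) (he : W V f A = W V f B) (x : ℤ) :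
    f x * ind A x = f x * ind B x := by
  have h0 : ∑ᶠ y, (f y * (ind B y - ind V y) - f y * (ind A y - ind V y)) = 0 := by
    rw [finsum_sub_distrib (supp_fin hB hV f) (supp_fin hA hV f)]
    unfold W at he
    linarith
  have hfin := ((supp_fin hB hV f).union (supp_fin hA hV f)).subset (Function.support_sub _ _)
  have := single_le_finsum x hfin (fun y => by have := h y; simp only [mul_sub]; linarith)
  rw [h0] at this
  have h2 := h x
  simp only [mul_sub] at this
  linarith

theorem W_one_Iio (s : ℤ) : W {x | x < 0} (fun _ => 1) {x | x < s} = s := by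
  have step : ∀ t : ℤ, W {x | x < 0} (fun _ => 1) {x | x < t + 1}
      = W {x | x < 0} (fun _ => 1) {x | x < t} + 1 := by
    intro t
    rw [← W_insert (maya_Iio t) (maya_Iio 0) (fun _ => 1) (x := t) (by simp)]
    congr 1
    ext y; simp; omega
  induction s using Int.induction_on with
  | zero => simp [W]
  | succ i ih => rw [step, ih]
  | pred i ih =>
    have := step (-(i:ℤ) - 1)
    rw [sub_add_cancel, ih] at this
    linarith

theorem abacus_decomp (s : ℤ) (lam : Ptn) (N : ℕ) (hN : ∀ n, N ≤ n → lam.parts n = 0) :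
    abacus s lam = {x | x < s - N} ∪
      (((Finset.range N).image fun j : ℕ => (lam.parts j : ℤ) - ((j : ℤ) + 1) + s : Finset ℤ) : Set ℤ) := by
  ext x
  simp only [abacus, Set.mem_ofPred_eq, Set.mem_union, Finset.coe_image, Set.mem_image,
    Finset.coe_range, Set.mem_Iio]
  constructor
  · rintro ⟨j, hj⟩
    by_cases h : j < N
    · exact Or.inr ⟨j, h, hj.symm⟩
    · left
      rw [hN j (by omega)] at hj
      push_cast at hj
      omega
  · rintro (h | ⟨j, hj, h⟩)
    · refine ⟨(s - x - 1).toNat, ?_⟩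
      rw [hN _ (by omega)]
      push_cast
      omega
    · exact ⟨j, h.symm⟩

theorem abacus_maya (s : ℤ) (lam : Ptn) : Maya (abacus s lam) := by
  obtain ⟨N, hN⟩ := lam.eventually_zero
  rw [abacus_decomp s lam N hN]
  exact maya_union_finset (maya_Iio _) _

theorem beads_inj (s : ℤ) (lam : Ptn) :
    StrictAnti fun j : ℕ => (lam.parts j : ℤ) - ((j : ℤ) + 1) + s := by
  intro i j h
  have := lam.antitone' h.le
  simp only
  omega

theorem W_abacus {V : Set ℤ} (hV : Maya V) (f : ℤ → ℤ) (s : ℤ) (lam : Ptn) (N : ℕ)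
    (hN : ∀ n, N ≤ n → lam.parts n = 0) :
    W V f (abacus s lam) = W V f {x | x < s - N} +
      ∑ j ∈ Finset.range N, f ((lam.parts j : ℤ) - ((j : ℤ) + 1) + s) := by
  rw [abacus_decomp s lam N hN, W_finset (maya_Iio _) hV]
  · rw [Finset.sum_image (fun a _ b _ h => (beads_inj s lam).injective h)]
  · intro x hx
    simp only [Finset.mem_image, Finset.mem_range] at hx
    obtain ⟨j, hj, rfl⟩ := hx
    simp
    omega

theorem W_abacus' {V : Set ℤ} (hV : Maya V) (f : ℤ → ℤ) (s : ℤ) (lam : Ptn) (N : ℕ)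
    (hN : ∀ n, N ≤ n → lam.parts n = 0) :
    W V f (abacus s lam) = W V f {x | x < s} +
      ∑ j ∈ Finset.range N, ∑ b ∈ Finset.range (lam.parts j),
        (f ((b : ℤ) - j + s) - f ((b : ℤ) - j + s - 1)) := by
  have h1 := W_abacus hV f s lam N hN
  have h2 := W_abacus hV f s Ptn.empty N (fun _ _ => rfl)
  have h3 : abacus s Ptn.empty = {x | x < s} := by
    rw [abacus_decomp s Ptn.empty 0 (fun _ _ => rfl)]; simp
  rw [h3] at h2
  have h4 : ∀ j ∈ Finset.range N, ∑ b ∈ Finset.range (lam.parts j),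
        (f ((b : ℤ) - j + s) - f ((b : ℤ) - j + s - 1)) =
        f ((lam.parts j : ℤ) - ((j : ℤ) + 1) + s) -
          f ((Ptn.empty.parts j : ℤ) - ((j : ℤ) + 1) + s) := by
    intro j _
    have := Finset.sum_range_sub (fun b : ℕ => f ((b : ℤ) - (j + 1) + s)) (lam.parts j)
    simp only [Ptn.empty]
    rw [← this]
    apply Finset.sum_congr rfl
    intro b _
    congr 2 <;> push_cast <;> ring
  rw [Finset.sum_congr rfl h4, Finset.sum_sub_distrib]
  linarith

theorem W_one_abacus (s : ℤ) (lam : Ptn) : W {x | x < 0} (fun _ => 1) (abacus s lam) = s := by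
  obtain ⟨N, hN⟩ := lam.eventually_zero
  rw [W_abacus' (maya_Iio 0) _ s lam N hN, W_one_Iio]
  simp

theorem abacus_inj {s t : ℤ} {lam mu : Ptn} (h : abacus s lam = abacus t mu) :
    s = t ∧ lam = mu := by
  have hst : s = t := by rw [← W_one_abacus s lam, h, W_one_abacus]
  subst hst
  refine ⟨rfl, ?_⟩
  have hr : Set.range (fun j : ℕ => -((lam.parts j : ℤ) - ((j : ℤ) + 1) + s)) =
      Set.range (fun j : ℕ => -((mu.parts j : ℤ) - ((j : ℤ) + 1) + s)) := by
    have key : ∀ nu : Ptn, Set.range (fun j : ℕ => -((nu.parts j : ℤ) - ((j : ℤ) + 1) + s))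
        = {x | -x ∈ abacus s nu} := by
      intro nu
      ext x
      simp only [Set.mem_range, abacus, Set.mem_ofPred_eq]
      constructor <;> rintro ⟨j, hj⟩ <;> exact ⟨j, by omega⟩
    rw [key, key, h]
  have := (StrictMono.range_inj (f := fun j : ℕ => -((lam.parts j : ℤ) - ((j : ℤ) + 1) + s))
    (g := fun j : ℕ => -((mu.parts j : ℤ) - ((j : ℤ) + 1) + s))
    (beads_inj s lam).neg (beads_inj s mu).neg).1 hr
  have hp : lam.parts = mu.parts := by
    funext j
    have := congrFun this j
    omega
  cases lam; cases mu; simp at hp; subst hp; rfl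

theorem maya_abacus {A : Set ℤ} (hA : Maya A) : ∃ s lam, abacus s lam = A := by
  classical
  obtain ⟨a, b, h1, h2⟩ := hA
  set P : ℕ → Prop := fun n => b - 1 - (n : ℤ) ∈ A with hP
  have hlarge : ∀ n : ℕ, b - a ≤ n → P n := fun n hn => h1 _ (by omega)
  have hinf : {n | P n}.Infinite := by
    intro hf
    obtain ⟨M, hM⟩ := hf.bddAbove
    have := hM (hlarge (max (M + 1) (b - a).toNat) (by omega))
    omega
  set g := Nat.nth P with hg
  have hmono : StrictMono g := Nat.nth_strictMono hinf
  have hle : ∀ j, j ≤ g j := fun _ => hmono.le_apply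
  have hstep : ∀ j : ℕ, (b - a).toNat ≤ j → g (j + 1) = g j + 1 := by
    intro j hj
    have h3 : P (g j + 1) := hlarge _ (by have := hle j; omega)
    obtain ⟨k, hk⟩ : ∃ k, g k = g j + 1 := by
      have : g j + 1 ∈ Set.range (Nat.nth P) := by rw [Nat.range_nth_of_infinite hinf]; exact h3
      exact this
    have hjk : j < k := hmono.lt_iff_lt.1 (by omega)
    have h5 : g (j + 1) ≤ g k := hmono.monotone hjk
    have h6 : g j < g (j + 1) := hmono (Nat.lt_succ_self j)
    omega
  have hanti : ∀ i j : ℕ, i ≤ j → (g i : ℤ) - i ≤ g j - j := by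
    intro i j hij
    induction j, hij using Nat.le_induction with
    | base => exact le_rfl
    | succ k _ ih =>
      have : g k < g (k + 1) := hmono (Nat.lt_succ_self k)
      push_cast
      omega
  set N := (b - a).toNat with hNdef
  set d : ℤ := (g N : ℤ) - N with hd
  have hconst : ∀ j : ℕ, N ≤ j → (g j : ℤ) - j = d := by
    intro j hj
    induction j, hj using Nat.le_induction with
    | base => rfl
    | succ k hk ih => rw [hstep k hk]; push_cast; omega
  have hled : ∀ j : ℕ, (g j : ℤ) - j ≤ d := by
    intro j
    rcases le_total j N with h | h
    · exact hanti j N h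
    · exact (hconst j h).le
  refine ⟨b - d, ⟨fun j => (d - (g j - j)).toNat, ?_, N, ?_⟩, ?_⟩
  · intro i j hij
    have := hanti i j hij
    omega
  · intro n hn
    have := hconst n hn
    omega
  · ext x
    simp only [abacus, Set.mem_ofPred_eq]
    constructor
    · rintro ⟨j, hj⟩
      have h3 : P (g j) := Nat.nth_mem_of_infinite hinf j
      have h4 := hled j
      simp only [hP] at h3
      convert h3 using 1
      omega
    · intro hx
      have hxb : x < b := by
        by_contra h
        exact h2 x (by omega) hx
      have h3 : P (b - 1 - x).toNat := by
        simp only [hP]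
        convert hx using 1
        omega
      have : (b - 1 - x).toNat ∈ Set.range (Nat.nth P) := by
        rw [Nat.range_nth_of_infinite hinf]; exact h3
      obtain ⟨j, hj⟩ := this
      have h4 := hled j
      refine ⟨j, ?_⟩
      change g j = _ at hj
      omega

/-- The `k`-th component of the abacus of a pair. -/
def abac {l : ℕ} (p : (Fin l → Ptn) × (Fin l → ℤ)) (k : Fin l) : Set ℤ := abacus (p.2 k) (p.1 k)

theorem abac_maya {l : ℕ} (p : (Fin l → Ptn) × (Fin l → ℤ)) (k : Fin l) : Maya (abac p k) :=
  abacus_maya _ _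

theorem abac_ext {l : ℕ} {p q : (Fin l → Ptn) × (Fin l → ℤ)} (h : ∀ k, abac p k = abac q k) :
    p = q := by
  have h' := fun k => abacus_inj (h k)
  exact Prod.ext (funext fun k => (h' k).2) (funext fun k => (h' k).1)

theorem sum_change {l : ℕ} (F G : Fin l → ℤ) (i j : Fin l) (hij : i ≠ j)
    (h : ∀ k, k ≠ i → k ≠ j → F k = G k) :
    ∑ k, F k = ∑ k, G k + ((F i - G i) + (F j - G j)) := by
  have := Fintype.sum_eq_add (f := fun k => F k - G k) i j hij
    (fun k hk => by simp [h k hk.1 hk.2])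
  rw [Finset.sum_sub_distrib] at this
  linarith

theorem elemOp_change {e l : ℕ} {p q : (Fin l → Ptn) × (Fin l → ℤ)} (h : ElemOp e p q) :
    ∃ (i j : Fin l) (x y : ℤ), (((j : ℕ) = i + 1 ∧ y = x) ∨
      ((i : ℕ) = l - 1 ∧ (j : ℕ) = 0 ∧ y = x - e)) ∧
      ∀ (V : Fin l → Set ℤ) (f : Fin l → ℤ → ℤ), (∀ k, Maya (V k)) →
        ∑ k, W (V k) (f k) (abac q k) = ∑ k, W (V k) (f k) (abac p k) + (f j y - f i x) := by
  have key : ∀ (i j : Fin l) (x y : ℤ), i ≠ j → x ∈ abac p i → y ∉ abac p j →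
      abac q i = abac p i \ {x} → abac q j = abac p j ∪ {y} →
      (∀ k, k ≠ i → k ≠ j → q.1 k = p.1 k ∧ q.2 k = p.2 k) →
      ∀ (V : Fin l → Set ℤ) (f : Fin l → ℤ → ℤ), (∀ k, Maya (V k)) →
        ∑ k, W (V k) (f k) (abac q k) = ∑ k, W (V k) (f k) (abac p k) + (f j y - f i x) := by
    intro i j x y hij hx hy h1 h2 h3 V f hV
    rw [sum_change (fun k => W (V k) (f k) (abac q k)) (fun k => W (V k) (f k) (abac p k)) i j hij]
    · rw [h1, h2, W_diff (abac_maya _ _) (hV i) _ hx, W_insert (abac_maya _ _) (hV j) _ hy]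
      ring
    · intro k hk1 hk2
      simp only [abac, h3 k hk1 hk2]
  rcases h with ⟨i, j, x, hij, hx, hy, h1, h2, -, -, h3⟩ | ⟨i, j, x, hi, hj, hx, hy, h1, h2, h3⟩
  · refine ⟨i, j, x, x, Or.inl ⟨hij, rfl⟩, key i j x x ?_ hx hy h1 h2 h3⟩
    rintro rfl
    omega
  · refine ⟨i, j, x, x - e, Or.inr ⟨hi, hj, rfl⟩, ?_⟩
    by_cases hij : i = j
    · subst hij
      have h4 : abac q i = abac p i \ {x} ∪ {x - (e : ℤ)} := (h1 rfl).1
      intro V f hV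
      have hsum : ∑ k, (W (V k) (f k) (abac q k) - W (V k) (f k) (abac p k)) =
          W (V i) (f i) (abac q i) - W (V i) (f i) (abac p i) := by
        apply Fintype.sum_eq_single
        intro k hk
        simp only [abac, h3 k hk hk, sub_self]
      rw [h4, W_insert (maya_diff (abac_maya _ _) _) (hV i) _ (fun h => hy h.1),
        W_diff (abac_maya _ _) (hV i) _ hx, Finset.sum_sub_distrib] at hsum
      linarith
    · exact key i j x _ hij hx hy (h2 hij).1 (h2 hij).2.1 h3

theorem exists_pair {l : ℕ} (A : Fin l → Set ℤ) (hA : ∀ k, Maya (A k)) :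
    ∃ q : (Fin l → Ptn) × (Fin l → ℤ), ∀ k, abac q k = A k := by
  choose s lam h using fun k => maya_abacus (hA k)
  exact ⟨(lam, s), h⟩

theorem abac_charge {l : ℕ} (p : (Fin l → Ptn) × (Fin l → ℤ)) (k : Fin l) :
    p.2 k = W {x | x < 0} (fun _ => 1) (abac p k) := (W_one_abacus _ _).symm

theorem exists_op {e l : ℕ} (p : (Fin l → Ptn) × (Fin l → ℤ)) (h : ¬ Complete e p.2 p.1) :
    ∃ q, ElemOp e p q := by
  classical
  have key : ∀ (i j : Fin l) (x y : ℤ), i ≠ j → x ∈ abac p i → y ∉ abac p j →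
      ∃ q : (Fin l → Ptn) × (Fin l → ℤ), abac q i = abac p i \ {x} ∧ abac q j = abac p j ∪ {y} ∧
      q.2 i = p.2 i - 1 ∧ q.2 j = p.2 j + 1 ∧
      (∀ k, k ≠ i → k ≠ j → q.1 k = p.1 k ∧ q.2 k = p.2 k) := by
    intro i j x y hij hx hy
    obtain ⟨q, hq⟩ := exists_pair (fun k => if k = i then abac p i \ {x} else
      if k = j then abac p j ∪ {y} else abac p k) (by
        intro k
        split_ifs
        · exact maya_diff (abac_maya _ _) _
        · exact maya_union (abac_maya _ _) _
        · exact abac_maya _ _)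
    have h1 : abac q i = abac p i \ {x} := by simpa using hq i
    have h2 : abac q j = abac p j ∪ {y} := by simpa [hij.symm] using hq j
    refine ⟨q, h1, h2, ?_, ?_, ?_⟩
    · rw [abac_charge, abac_charge, h1, W_diff (abac_maya _ _) (maya_Iio 0) _ hx]
    · rw [abac_charge, abac_charge p, h2, W_insert (abac_maya _ _) (maya_Iio 0) _ hy]
    · intro k h3 h4
      have h5 : abac q k = abac p k := by simpa [h3, h4] using hq k
      exact (abacus_inj h5).symm
  unfold Complete at h
  rw [not_and_or] at h
  rcases h with h | h
  · push Not at h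
    obtain ⟨i, j, hij, hs⟩ := h
    obtain ⟨x, hx, hy⟩ := Set.not_subset.1 hs
    obtain ⟨q, h1, h2, h3, h4, h5⟩ := key i j x x (by rintro rfl; omega) hx hy
    exact ⟨q, Or.inl ⟨i, j, x, hij, hx, hy, h1, h2, h3, h4, h5⟩⟩
  · push Not at h
    obtain ⟨i, j, hi, hj, hs⟩ := h
    obtain ⟨x, hx, hy⟩ := Set.not_subset.1 hs
    change x - (e : ℤ) ∉ abac p j at hy
    by_cases hij : i = j
    · subst hij
      obtain ⟨q, hq⟩ := exists_pair (fun k => if k = i then abac p i \ {x} ∪ {x - (e : ℤ)}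
        else abac p k) (by
          intro k
          split_ifs
          · exact maya_union (maya_diff (abac_maya _ _) _) _
          · exact abac_maya _ _)
      have h1 : abac q i = abac p i \ {x} ∪ {x - (e : ℤ)} := by simpa using hq i
      refine ⟨q, Or.inr ⟨i, i, x, hi, hj, hx, hy, fun _ => ⟨h1, ?_⟩, fun h => absurd rfl h, ?_⟩⟩
      · rw [abac_charge, abac_charge p, h1, W_insert (maya_diff (abac_maya _ _) _) (maya_Iio 0) _
          (fun h => hy h.1), W_diff (abac_maya _ _) (maya_Iio 0) _ hx]
        ring
      · intro k h3 _
        have h5 : abac q k = abac p k := by simpa [h3] using hq k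
        exact (abacus_inj h5).symm
    · obtain ⟨q, h1, h2, h3, h4, h5⟩ := key i j x _ hij hx hy
      exact ⟨q, Or.inr ⟨i, j, x, hi, hj, hx, hy, fun h => absurd h hij,
        fun _ => ⟨h1, h2, h3, h4⟩, h5⟩⟩

/-- Energy weight of the position `x` on component `k`. -/
def ew (e l : ℕ) (k : Fin l) (x : ℤ) : ℤ := x * l - e * ((k : ℕ) : ℤ)

/-- Energy of a pair. -/
noncomputable def energy (e : ℕ) {l : ℕ} (p : (Fin l → Ptn) × (Fin l → ℤ)) : ℤ :=
  ∑ k, W {x | ew e l k x < 0} (ew e l k) (abac p k)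

theorem ew_maya (e l : ℕ) (k : Fin l) : Maya {x | ew e l k x < 0} := by
  have hl : (1 : ℤ) ≤ l := by have := k.2; omega
  have hek : (0 : ℤ) ≤ e * ((k : ℕ) : ℤ) := by positivity
  refine ⟨0, e * ((k : ℕ) : ℤ), fun x hx => ?_, fun x hx => ?_⟩
  · simp only [ew, Set.mem_ofPred_eq]
    nlinarith
  · simp only [ew, Set.mem_ofPred_eq]
    nlinarith

theorem energy_nonneg (e : ℕ) {l : ℕ} (p : (Fin l → Ptn) × (Fin l → ℤ)) : 0 ≤ energy e p := by
  apply Finset.sum_nonneg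
  intro k _
  apply finsum_nonneg
  intro x
  unfold ind
  by_cases h : ew e l k x < 0
  · by_cases h2 : x ∈ abac p k <;> simp [h, h2] <;> omega
  · by_cases h2 : x ∈ abac p k <;> simp [h, h2] <;> omega

theorem energy_step {e l : ℕ} (he : 2 ≤ e) {p q : (Fin l → Ptn) × (Fin l → ℤ)}
    (h : ElemOp e p q) : energy e q < energy e p := by
  obtain ⟨i, j, x, y, hxy, hc⟩ := elemOp_change h
  have := hc (fun k => {x | ew e l k x < 0}) (ew e l) (ew_maya e l)
  unfold energy
  rw [this]
  have h2 : ew e l j y - ew e l i x = - e := by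
    unfold ew
    rcases hxy with ⟨h1, rfl⟩ | ⟨h1, h2, rfl⟩
    · rw [h1]; push_cast; ring
    · rw [h1, h2, Nat.cast_sub (by have := i.2; omega)]; push_cast; ring
  rw [h2]
  omega

theorem core_cons {e l : ℕ} {p p' q : (Fin l → Ptn) × (Fin l → ℤ)} (h : ElemOp e p p')
    (hc : IsCorePairOf e p' q) : IsCorePairOf e p q := by
  obtain ⟨f, n, ⟨⟨h0, hs⟩, hcomp⟩, hq⟩ := hc
  refine ⟨fun k => Nat.casesOn k p f, n + 1, ⟨⟨rfl, ?_⟩, hcomp⟩, hq⟩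
  intro k hk
  cases k with
  | zero => simpa [h0] using h
  | succ k => exact hs k (by omega)

theorem exists_core {e l : ℕ} (he : 2 ≤ e) (m : ℕ) : ∀ p : (Fin l → Ptn) × (Fin l → ℤ),
    (energy e p).toNat = m → ∃ q, IsCorePairOf e p q := by
  induction m using Nat.strong_induction_on with
  | _ m ih =>
    intro p hp
    by_cases hc : Complete e p.2 p.1
    · exact ⟨p, fun _ => p, 0, ⟨⟨rfl, fun k hk => absurd hk (by omega)⟩, hc⟩, rfl⟩
    · obtain ⟨p', h⟩ := exists_op p hc
      have h1 := energy_step he h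
      have h2 := energy_nonneg e p'
      obtain ⟨q, hq⟩ := ih _ (by omega) p' rfl
      exact ⟨q, core_cons h hq⟩

/-- Indicator of a residue class. -/
def rw1 (e : ℕ) (i : ZMod e) (x : ℤ) : ℤ := if (x : ZMod e) = i then 1 else 0

/-- Charge of the runner of residue `i`. -/
noncomputable def chg (e : ℕ) {l : ℕ} (i : ZMod e) (p : (Fin l → Ptn) × (Fin l → ℤ)) : ℤ :=
  ∑ k, W {x | x < 0} (rw1 e i) (abac p k)

theorem chg_step {e l : ℕ} (i : ZMod e) {p q : (Fin l → Ptn) × (Fin l → ℤ)}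
    (h : ElemOp e p q) : chg e i q = chg e i p := by
  obtain ⟨a, b, x, y, hxy, hc⟩ := elemOp_change h
  have := hc (fun _ => {x | x < 0}) (fun _ => rw1 e i) (fun _ => maya_Iio 0)
  unfold chg
  rw [this]
  have : rw1 e i y = rw1 e i x := by
    rcases hxy with ⟨h1, rfl⟩ | ⟨h1, h2, rfl⟩
    · rfl
    · simp [rw1]
  linarith

theorem chg_core {e l : ℕ} (i : ZMod e) {p q : (Fin l → Ptn) × (Fin l → ℤ)}
    (h : IsCorePairOf e p q) : chg e i q = chg e i p := by
  obtain ⟨f, n, ⟨⟨h0, hs⟩, hcomp⟩, rfl⟩ := h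
  rw [← h0]
  have : ∀ k, k ≤ n → chg e i (f k) = chg e i (f 0) := by
    intro k
    induction k with
    | zero => intro _; rfl
    | succ k ih => intro hk; rw [chg_step i (hs k (by omega)), ih (by omega)]
  exact this n le_rfl

theorem complete_core {e l : ℕ} {p q : (Fin l → Ptn) × (Fin l → ℤ)}
    (h : IsCorePairOf e p q) : Complete e q.2 q.1 := by
  obtain ⟨f, n, ⟨_, hcomp⟩, rfl⟩ := h
  exact hcomp

theorem complete_chain {e l : ℕ} {p : (Fin l → Ptn) × (Fin l → ℤ)}
    (h : Complete e p.2 p.1) (c d : Fin l) (hcd : c ≤ d) : abac p c ⊆ abac p d := by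
  have : ∀ n : ℕ, ∀ d : Fin l, (d : ℕ) = c + n → abac p c ⊆ abac p d := by
    intro n
    induction n with
    | zero => intro d hd; rw [show d = c from Fin.ext (by omega)]
    | succ n ih =>
      intro d hd
      have := ih ⟨c + n, by omega⟩ rfl
      exact this.trans (h.1 _ _ (by simp; omega))
  exact this (d - c) d (by have : (c : ℕ) ≤ d := hcd; omega)

theorem complete_down {e l : ℕ} {p : (Fin l → Ptn) × (Fin l → ℤ)}
    (h : Complete e p.2 p.1) (c d : Fin l) (y : ℤ) (hy : y ∈ abac p d) (n : ℕ) :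
    y - (e : ℤ) * (n + 1) ∈ abac p c := by
  have hl : 0 < l := by have := c.2; omega
  have step : ∀ (c d : Fin l) (y : ℤ), y ∈ abac p d → y - (e : ℤ) ∈ abac p c := by
    intro c d y hy
    have h1 := complete_chain h d ⟨l - 1, by omega⟩ (by
      rw [Fin.le_def]; have := d.2; simp only; omega) hy
    have h2 : y - (e : ℤ) ∈ abac p ⟨0, hl⟩ := h.2 ⟨l - 1, by omega⟩ ⟨0, hl⟩ rfl rfl h1
    exact complete_chain h ⟨0, hl⟩ c (by rw [Fin.le_def]; simp) h2
  induction n with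
  | zero => simpa using step c d y hy
  | succ n ih =>
    have := step c c _ ih
    convert this using 1
    push_cast; ring

theorem complete_order {e l : ℕ} {p : (Fin l → Ptn) × (Fin l → ℤ)}
    (h : Complete e p.2 p.1) (c d : Fin l) (x y : ℤ) (hy : y ∈ abac p d)
    (hxy : (x : ZMod e) = y) (ho : x < y ∨ (x = y ∧ d ≤ c)) : x ∈ abac p c := by
  rcases ho with ho | ⟨rfl, ho⟩
  · have h1 : (e : ℤ) ∣ y - x := by
      rw [← ZMod.intCast_zmod_eq_zero_iff_dvd] <;> simp [hxy]
    obtain ⟨m, hm⟩ := h1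
    have hm0 : 0 < m := by
      by_contra hneg
      have : (e : ℤ) * m ≤ 0 := mul_nonpos_of_nonneg_of_nonpos (by positivity) (by omega)
      omega
    obtain ⟨n, rfl⟩ : ∃ n : ℕ, m = n + 1 := ⟨(m - 1).toNat, by omega⟩
    have := complete_down h c d y hy n
    rw [← hm] at this
    simpa using this
  · exact complete_chain h d c ho hy

theorem complete_sub_eq {e l : ℕ} {p q : (Fin l → Ptn) × (Fin l → ℤ)} (r : ZMod e)
    (hchg : chg e r p = chg e r q)
    (hsub : ∀ (k : Fin l) (x : ℤ), (x : ZMod e) = r → x ∈ abac p k → x ∈ abac q k) :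
    ∀ (k : Fin l) (x : ℤ), (x : ZMod e) = r → x ∈ abac q k → x ∈ abac p k := by
  have hle : ∀ k x, rw1 e r x * ind (abac p k) x ≤ rw1 e r x * ind (abac q k) x := by
    intro k x
    by_cases hx : (x : ZMod e) = r
    · by_cases h1 : x ∈ abac p k
      · simp [rw1, ind, hx, h1, hsub k x hx h1]
      · by_cases h2 : x ∈ abac q k <;> simp [rw1, ind, hx, h1, h2]
    · simp [rw1, hx]
  have h1 := (Finset.sum_eq_sum_iff_of_le (fun k (_ : k ∈ Finset.univ) =>
    W_mono (abac_maya p k) (abac_maya q k) (maya_Iio 0) (rw1 e r) (hle k))).1 hchg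
  intro k x hx hq
  have h2 := W_mono_eq (abac_maya p k) (abac_maya q k) (maya_Iio 0) (rw1 e r) (hle k)
    (h1 k (Finset.mem_univ k)) x
  by_contra hn
  simp [rw1, ind, hx, hq, hn] at h2

theorem complete_unique {e l : ℕ} {p q : (Fin l → Ptn) × (Fin l → ℤ)}
    (hp : Complete e p.2 p.1) (hq : Complete e q.2 q.1)
    (hchg : ∀ r : ZMod e, chg e r p = chg e r q) : p = q := by
  have main : ∀ r : ZMod e, ∀ (k : Fin l) (x : ℤ), (x : ZMod e) = r → (x ∈ abac p k ↔ x ∈ abac q k) := by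
    intro r
    by_cases h : ∀ (k : Fin l) (x : ℤ), (x : ZMod e) = r → x ∈ abac p k → x ∈ abac q k
    · exact fun k x hx => ⟨h k x hx, complete_sub_eq r (hchg r) h k x hx⟩
    · have h' : ∀ (k : Fin l) (x : ℤ), (x : ZMod e) = r → x ∈ abac q k → x ∈ abac p k := by
        push Not at h
        obtain ⟨d, y, hy, hyp, hyq⟩ := h
        intro c x hx hxq
        by_contra hxp
        rcases lt_trichotomy x y with hlt | heq | hlt
        · exact hxp (complete_order hp c d x y hyp (hx.trans hy.symm) (Or.inl hlt))
        · rcases le_total d c with hdc | hdc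
          · exact hxp (complete_order hp c d x y hyp (hx.trans hy.symm) (Or.inr ⟨heq, hdc⟩))
          · exact hyq (complete_order hq d c y x hxq (hy.trans hx.symm) (Or.inr ⟨heq.symm, hdc⟩))
        · exact hyq (complete_order hq d c y x hxq (hy.trans hx.symm) (Or.inl hlt))
      exact fun k x hx => ⟨complete_sub_eq r (hchg r).symm h' k x hx, h' k x hx⟩
  exact abac_ext fun k => Set.ext fun x => main _ k x rfl

theorem ncard_diag {l : ℕ} (lam : Fin l → Ptn) (N : ℕ)
    (hN : ∀ c, ∀ n, N ≤ n → (lam c).parts n = 0) (Q : ℕ × ℕ × Fin l → Prop) [DecidablePred Q] :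
    ({x ∈ diag lam | Q x}.ncard : ℤ) = ∑ c, ∑ a ∈ Finset.range N,
      ∑ b ∈ Finset.range ((lam c).parts a), if Q (a, b, c) then 1 else 0 := by
  have hset : {x ∈ diag lam | Q x} =
      ((((Finset.univ : Finset (Fin l)).sigma fun c => (Finset.range N).sigma fun a =>
        (Finset.range ((lam c).parts a)).filter fun b => Q (a, b, c)).image
        fun z => (z.2.1, z.2.2, z.1) : Finset (ℕ × ℕ × Fin l)) : Set (ℕ × ℕ × Fin l)) := by
    ext ⟨a, b, c⟩
    simp only [diag, Set.mem_ofPred_eq, Finset.coe_image, Set.mem_image, Finset.mem_coe,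
      Finset.mem_sigma, Finset.mem_univ, true_and, Finset.mem_range, Finset.mem_filter,
      Prod.mk.injEq]
    constructor
    · rintro ⟨h1, h2⟩
      refine ⟨⟨c, a, b⟩, ⟨?_, h1, h2⟩, rfl, rfl, rfl⟩
      by_contra hn
      rw [hN c a (not_lt.1 hn)] at h1
      omega
    · rintro ⟨⟨c', a', b'⟩, ⟨h1, h2, h3⟩, rfl, rfl, rfl⟩
      exact ⟨h2, h3⟩
  rw [hset, Set.ncard_coe_finset, Finset.card_image_of_injective, Finset.card_sigma]
  · push_cast
    apply Finset.sum_congr rfl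
    intro c _
    rw [Finset.card_sigma]
    push_cast
    apply Finset.sum_congr rfl
    intro a _
    rw [Finset.card_filter]
    push_cast
    rfl
  · rintro ⟨c, a, b⟩ ⟨c', a', b'⟩ h
    simp only [Prod.mk.injEq] at h
    obtain ⟨rfl, rfl, rfl⟩ := h
    rfl

theorem exists_bound {l : ℕ} (lam : Fin l → Ptn) :
    ∃ N : ℕ, ∀ c, ∀ n, N ≤ n → (lam c).parts n = 0 := by
  choose M hM using fun c => (lam c).eventually_zero
  exact ⟨∑ c, M c, fun c n hn => hM c n
    (le_trans (Finset.single_le_sum (f := M) (fun _ _ => Nat.zero_le _) (Finset.mem_univ c)) hn)⟩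

theorem chg_resCount (e : ℕ) {l : ℕ} (s : Fin l → ℤ) (lam : Fin l → Ptn) (i : ZMod e) :
    chg e i (lam, s) = ∑ k, W {x | x < 0} (rw1 e i) {x | x < s k} +
      ((resCount e s lam i : ℤ) - resCount e s lam (i + 1)) := by
  classical
  obtain ⟨N, hN⟩ := exists_bound lam
  unfold resCount chg
  rw [ncard_diag lam N hN, ncard_diag lam N hN, ← Finset.sum_sub_distrib, ← Finset.sum_add_distrib]
  apply Finset.sum_congr rfl
  intro k _
  unfold abac
  rw [W_abacus' (maya_Iio 0) _ _ _ N (hN k), ← Finset.sum_sub_distrib]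
  congr 1
  apply Finset.sum_congr rfl
  intro a _
  rw [← Finset.sum_sub_distrib]
  apply Finset.sum_congr rfl
  intro b _
  simp only [rw1, res]
  congr 1
  congr 1
  push_cast
  rw [eq_iff_iff, sub_eq_iff_eq_add]

theorem rank_sum (e : ℕ) [NeZero e] {l : ℕ} (s : Fin l → ℤ) (lam : Fin l → Ptn) :
    (rank lam : ℤ) = ∑ i : ZMod e, (resCount e s lam i : ℤ) := by
  classical
  obtain ⟨N, hN⟩ := exists_bound lam
  have h := ncard_diag lam N hN (fun _ => True)
  have h0 : {x ∈ diag lam | True} = diag lam := by ext; simp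
  rw [h0] at h
  unfold rank resCount
  rw [h, Finset.sum_congr rfl (fun i _ => ncard_diag lam N hN (fun x => res e s x = i))]
  symm
  rw [Finset.sum_comm]
  apply Finset.sum_congr rfl
  intro c _
  rw [Finset.sum_comm]
  apply Finset.sum_congr rfl
  intro a _
  rw [Finset.sum_comm]
  apply Finset.sum_congr rfl
  intro b _
  simp

/-- two `l`-partitions of the same rank have the same core if and only if
they have the same multiset of residues. -/
theorem stmt19 (e l : ℕ) (he : 2 ≤ e) (hl : 1 ≤ l) (s : Fin l → ℤ) (hs : Aset e s)
    (n : ℕ) (lam mu : Fin l → Ptn) (hlam : rank lam = n) (hmu : rank mu = n) :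
    (∃ p, IsCorePairOf e (lam, s) p ∧ IsCorePairOf e (mu, s) p) ↔
      (∀ i : ZMod e, resCount e s lam i = resCount e s mu i) := by
  have : NeZero e := ⟨by omega⟩
  constructor
  · rintro ⟨p, hp1, hp2⟩
    have hstep : ∀ i : ZMod e, (resCount e s lam (i + 1) : ℤ) - resCount e s mu (i + 1) =
        resCount e s lam i - resCount e s mu i := by
      intro i
      have h := (chg_core i hp1).symm.trans (chg_core i hp2)
      rw [chg_resCount, chg_resCount] at h
      linarith
    have hnat : ∀ k : ℕ, (resCount e s lam (k : ZMod e) : ℤ) - resCount e s mu (k : ZMod e) =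
        resCount e s lam 0 - resCount e s mu 0 := by
      intro k
      induction k with
      | zero => simp
      | succ k ih => rw [Nat.cast_succ, hstep, ih]
    have hall : ∀ i : ZMod e, (resCount e s lam i : ℤ) - resCount e s mu i =
        resCount e s lam 0 - resCount e s mu 0 := by
      intro i
      have := hnat i.val
      rwa [ZMod.natCast_zmod_val] at this
    have hsum : ∑ i : ZMod e, ((resCount e s lam i : ℤ) - resCount e s mu i) = 0 := by
      rw [Finset.sum_sub_distrib, ← rank_sum, ← rank_sum, hlam, hmu, sub_self]
    rw [Finset.sum_congr rfl (fun i _ => hall i), Finset.sum_const, Finset.card_univ, ZMod.card,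
      nsmul_eq_mul] at hsum
    have h0 : (resCount e s lam 0 : ℤ) - resCount e s mu 0 = 0 := by
      rcases mul_eq_zero.1 hsum with h | h
      · exfalso; norm_cast at h; omega
      · exact h
    intro i
    have := hall i
    omega
  · intro h
    obtain ⟨p, hp⟩ := exists_core he _ (lam, s) rfl
    obtain ⟨q, hq⟩ := exists_core he _ (mu, s) rfl
    have : p = q := by
      apply complete_unique (complete_core hp) (complete_core hq)
      intro r
      rw [chg_core r hp, chg_core r hq, chg_resCount, chg_resCount, h, h]
    exact ⟨p, hp, this ▸ hq⟩
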